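/- arXiv:1410.8123 — 4 statements merged into one kernel-verified Lean document; each statement's English description precedes it below -/
import Mathlib

section
/- Let y be a real random variable whose first k moments (k ≥ 2) match those of a standard Gaussian random variable, i.e. E[y^j] equals the j-th moment of N(0,1) for 1 ≤ j ≤ k. Let F : ℝ → ℝ be (k+1)-times continuously differentiable with ‖F^{(k-1)}‖_∞ < ∞ and ‖F^{(k)}‖_∞ < ∞. Then for every K ≥ 1, |E[y F(y)] − E[F'(y)]| ≤ (4‖F^{(k-1)}‖_∞/(k−2)!) · E[|y|^k ; |y| ≥ K] + ((k+1)K/k!) · ‖F^{(k)}‖_∞ · E[|y|^k]. -/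
open MeasureTheory ProbabilityTheory

/-- A function vanishing at `0` whose derivative is `O(|x| ^ n)` is `O(|x| ^ (n + 1))`, with the
constants given by integration. -/
lemma abs_le_of_abs_deriv_le_pow {g g' : ℝ → ℝ} {C : ℝ} {n : ℕ} (hg : ∀ x, HasDerivAt g (g' x) x)
    (h0 : g 0 = 0) (hb : ∀ x, |g' x| ≤ C * |x| ^ n / n.factorial) (x : ℝ) :
    |g x| ≤ C * |x| ^ (n + 1) / (n + 1).factorial := by
  have key : ∀ (f f' : ℝ → ℝ), (∀ x, HasDerivAt f (f' x) x) → f 0 = 0 →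
      (∀ x, |f' x| ≤ C * |x| ^ n / n.factorial) → ∀ x, 0 ≤ x →
      |f x| ≤ C * x ^ (n + 1) / (n + 1).factorial := by
    intro f f' hf hf0 hfb x hx
    have hB : ∀ t : ℝ, HasDerivAt (fun t : ℝ => C * t ^ (n + 1) / (n + 1).factorial)
        (C * t ^ n / n.factorial) t := by
      intro t
      convert! (((hasDerivAt_id t).pow (n + 1)).const_mul C).div_const
        ((n + 1).factorial : ℝ) using 1
      have : (n.factorial : ℝ) ≠ 0 := by positivity
      simp only [Nat.factorial_succ, id, Nat.add_sub_cancel]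
      push_cast
      field_simp
    refine image_norm_le_of_norm_deriv_right_le_deriv_boundary (a := 0) (b := x)
      (fun t _ => (hf t).continuousAt.continuousWithinAt)
      (fun t _ => (hf t).hasDerivWithinAt) (by simp [hf0]) hB (fun t ht => ?_) ⟨hx, le_rfl⟩
    have := hfb t
    rwa [abs_of_nonneg ht.1] at this
  rcases le_total 0 x with hx | hx
  · simpa [abs_of_nonneg hx] using key g g' hg h0 hb x hx
  · have := key (fun t => g (-t)) (fun t => -g' (-t))
      (fun t => by simpa [Function.comp_def] using (hg (-t)).scomp t (hasDerivAt_neg t))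
      (by simpa using h0) (fun t => by simpa using hb (-t)) (-x) (by linarith)
    simpa [abs_of_nonpos hx] using this

/-- The Taylor polynomial at `0` with `n` terms. -/
noncomputable def maclaurinSum (F : ℝ → ℝ) (n : ℕ) (x : ℝ) : ℝ :=
  ∑ j ∈ Finset.range n, iteratedDeriv j F 0 * x ^ j / j.factorial

lemma hasDerivAt_maclaurinSum (F : ℝ → ℝ) (n : ℕ) (x : ℝ) :
    HasDerivAt (maclaurinSum F (n + 1)) (maclaurinSum (deriv F) n x) x := by
  unfold maclaurinSum
  simp_rw [Finset.sum_range_succ' _ n, iteratedDeriv_succ', pow_zero]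
  refine HasDerivAt.add_const _ ?_
  refine HasDerivAt.fun_sum fun j _ => ?_
  convert! (((hasDerivAt_id x).pow (j + 1)).const_mul (iteratedDeriv j (deriv F) 0)).div_const
    ((j + 1).factorial : ℝ) using 1
  have : (j.factorial : ℝ) ≠ 0 := by positivity
  simp only [Nat.factorial_succ, id, Nat.add_sub_cancel]
  push_cast
  field_simp

lemma abs_sub_maclaurinSum_sub_le {n : ℕ} {c C : ℝ} {F : ℝ → ℝ} (hF : ContDiff ℝ n F)
    (hC : ∀ x, |iteratedDeriv n F x - c| ≤ C) (x : ℝ) :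
    |F x - maclaurinSum F n x - c * x ^ n / n.factorial| ≤ C * |x| ^ n / n.factorial := by
  induction n generalizing F x with
  | zero => simpa [maclaurinSum] using hC x
  | succ n ih =>
    have hF' : ContDiff ℝ n (deriv F) := by
      rw [Nat.cast_succ, contDiff_succ_iff_deriv] at hF
      exact hF.2.2
    refine abs_le_of_abs_deriv_le_pow (g' := fun x =>
      deriv F x - maclaurinSum (deriv F) n x - c * x ^ n / n.factorial)
      (g := fun x => F x - maclaurinSum F (n + 1) x - c * x ^ (n + 1) / (n + 1).factorial)
      (fun t => ?_) ?_ (fun t => ih hF' (by simpa [iteratedDeriv_succ'] using hC) t) x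
    · refine (((hF.differentiable (by simp)) t).hasDerivAt.sub
        (hasDerivAt_maclaurinSum F n t)).sub ?_
      convert! (((hasDerivAt_id t).pow (n + 1)).const_mul c).div_const
        ((n + 1).factorial : ℝ) using 1
      have : (n.factorial : ℝ) ≠ 0 := by positivity
      simp only [Nat.factorial_succ, id, Nat.add_sub_cancel]
      push_cast
      field_simp
    · simp [maclaurinSum, Finset.sum_range_succ']

lemma abs_sub_maclaurinSum_le {n : ℕ} {C : ℝ} {F : ℝ → ℝ} (hF : ContDiff ℝ n F)
    (hC : ∀ x, |iteratedDeriv n F x| ≤ C) (x : ℝ) :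
    |F x - maclaurinSum F n x| ≤ C * |x| ^ n / n.factorial := by
  simpa using abs_sub_maclaurinSum_sub_le (c := 0) hF (by simpa using hC) x

lemma abs_sub_maclaurinSum_succ_le {n : ℕ} {C : ℝ} {F : ℝ → ℝ} (hF : ContDiff ℝ n F)
    (hC : ∀ x, |iteratedDeriv n F x| ≤ C) (x : ℝ) :
    |F x - maclaurinSum F (n + 1) x| ≤ 2 * C * |x| ^ n / n.factorial := by
  have := abs_sub_maclaurinSum_sub_le (c := iteratedDeriv n F 0) (C := 2 * C) hF
    (fun x => (abs_sub _ _).trans (by linarith [hC x, hC 0])) x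
  rwa [sub_sub, maclaurinSum, ← Finset.sum_range_succ] at this

lemma integrable_pow_gaussianReal (n : ℕ) :
    Integrable (fun x : ℝ => x ^ n) (gaussianReal 0 1) := by
  have h := (memLp_id_gaussianReal' (μ := 0) (v := 1) n (by simp)).integrable_norm_pow'
  refine (integrable_norm_iff (by fun_prop)).1 ?_
  simpa using h

/-- The moment recursion of the standard Gaussian measure. -/
lemma integral_pow_add_two_gaussianReal (n : ℕ) :
    ∫ x, x ^ (n + 2) ∂(gaussianReal 0 1) = (n + 1) * ∫ x, x ^ n ∂(gaussianReal 0 1) := by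
  have hint : ∀ j : ℕ, Integrable (fun x : ℝ => x ^ j * gaussianPDFReal 0 1 x) := by
    intro j
    have := integrable_pow_gaussianReal j
    rw [gaussianReal_of_var_ne_zero _ one_ne_zero, integrable_withDensity_iff
      (measurable_gaussianPDF 0 1) (by simp [gaussianPDF])] at this
    simpa using this
  have hder : ∀ x : ℝ, HasDerivAt (gaussianPDFReal 0 1) (-x * gaussianPDFReal 0 1 x) x := by
    intro x
    unfold gaussianPDFReal
    have h1 : HasDerivAt (fun x : ℝ => -(x - 0) ^ 2 / (2 * ((1 : NNReal) : ℝ))) (-x) x := by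
      convert! ((((hasDerivAt_id x).sub_const 0).pow 2).neg).div_const
        (2 * ((1 : NNReal) : ℝ)) using 1
      simp
      ring
    convert! h1.exp.const_mul (√(2 * Real.pi * ((1 : NNReal) : ℝ)))⁻¹ using 1
    ring
  have h := integral_mul_deriv_eq_deriv_mul_of_integrable (u := fun x : ℝ => x ^ (n + 1))
    (u' := fun x : ℝ => (n + 1) * x ^ n) (v := gaussianPDFReal 0 1)
    (v' := fun x => -x * gaussianPDFReal 0 1 x)
    (fun x _ => by simpa using hasDerivAt_pow (n + 1) x) (fun x _ => hder x)
    ((hint (n + 2)).neg.congr (ae_of_all _ fun x => by simp; ring))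
    (((hint n).const_mul ((n : ℝ) + 1)).congr (ae_of_all _ fun x => by simp; ring))
    (hint (n + 1))
  rw [integral_gaussianReal_eq_integral_smul one_ne_zero,
    integral_gaussianReal_eq_integral_smul one_ne_zero, ← integral_const_mul]
  simp only [smul_eq_mul]
  rw [← neg_inj, ← integral_neg]
  convert! h using 1
  · exact integral_congr_ae (ae_of_all _ fun x => by ring)
  · congr 1
    exact integral_congr_ae (ae_of_all _ fun x => by ring)

/-- For nonnegative `x`, `x ^ (m + 2) - x ^ (m + 1)` dominates `(x ^ 2 - 1) / 2`. -/
lemma half_sq_sub_one_le_pow_sub_pow {x : ℝ} (hx : 0 ≤ x) (m : ℕ) :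
    (x ^ 2 - 1) / 2 ≤ x ^ (m + 2) - x ^ (m + 1) := by
  have h : 0 ≤ (x - 1) * (x ^ (m + 1) - (x + 1) / 2) := by
    rcases le_total 1 x with h1 | h1
    · have : x ≤ x ^ (m + 1) := le_self_pow₀ h1 (by simp)
      exact mul_nonneg (by linarith) (by linarith)
    · have : x ^ (m + 1) ≤ x := pow_le_of_le_one hx h1 (by simp)
      exact mul_nonneg_of_nonpos_of_nonpos (by linarith) (by linarith)
  have e : x ^ (m + 2) = x ^ (m + 1) * x := pow_succ _ _
  nlinarith

section GaussianMoments

variable {Ω : Type*} [MeasurableSpace Ω] {P : Measure Ω} {y : Ω → ℝ}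

lemma integrable_maclaurinSum {F : ℝ → ℝ} {n : ℕ}
    (h : ∀ j < n, Integrable (fun ω => y ω ^ j) P) :
    Integrable (fun ω => maclaurinSum F n (y ω)) P :=
  integrable_finsetSum _ fun j hj =>
    ((h j (Finset.mem_range.1 hj)).const_mul _).div_const _

lemma integrable_mul_maclaurinSum {F : ℝ → ℝ} {n : ℕ}
    (h : ∀ j ≤ n, Integrable (fun ω => y ω ^ j) P) :
    Integrable (fun ω => y ω * maclaurinSum F n (y ω)) P := by
  simp only [maclaurinSum, Finset.mul_sum]
  refine integrable_finsetSum _ fun j hj => ?_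
  refine (((h (j + 1) (Finset.mem_range.1 hj)).const_mul
    (iteratedDeriv j F 0)).div_const (j.factorial : ℝ)).congr (ae_of_all _ fun ω => ?_)
  simp only [pow_succ]
  ring

/-- Gaussian integration by parts for Taylor polynomials, under moment matching. -/
lemma integral_mul_maclaurinSum_eq {F : ℝ → ℝ} {n : ℕ}
    (h : ∀ j ≤ n + 1, Integrable (fun ω => y ω ^ j) P) (h1 : ∫ ω, y ω ∂P = 0)
    (hrec : ∀ j < n, ∫ ω, y ω ^ (j + 2) ∂P = (j + 1) * ∫ ω, y ω ^ j ∂P) :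
    ∫ ω, y ω * maclaurinSum F (n + 1) (y ω) ∂P = ∫ ω, maclaurinSum (deriv F) n (y ω) ∂P := by
  have e : ∀ ω, y ω * maclaurinSum F (n + 1) (y ω) =
      ∑ j ∈ Finset.range (n + 1), iteratedDeriv j F 0 / j.factorial * y ω ^ (j + 1) := by
    intro ω
    simp only [maclaurinSum, Finset.mul_sum]
    exact Finset.sum_congr rfl fun j _ => by ring
  have e' : ∀ ω, maclaurinSum (deriv F) n (y ω) =
      ∑ j ∈ Finset.range n, iteratedDeriv (j + 1) F 0 / j.factorial * y ω ^ j := by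
    intro ω
    simp only [maclaurinSum, iteratedDeriv_succ']
    exact Finset.sum_congr rfl fun j _ => by ring
  simp only [e, e']
  rw [integral_finsetSum _ fun j hj => (h (j + 1) (Finset.mem_range.1 hj)).const_mul _,
    integral_finsetSum _ fun j hj =>
      (h j (by have := Finset.mem_range.1 hj; omega)).const_mul _, Finset.sum_range_succ']
  simp only [integral_const_mul, zero_add, pow_one, h1, mul_zero, add_zero]
  refine Finset.sum_congr rfl fun j hj => ?_
  rw [hrec j (Finset.mem_range.1 hj)]
  have : (j.factorial : ℝ) ≠ 0 := by positivity
  simp only [Nat.factorial_succ]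
  push_cast
  field_simp

end GaussianMoments

/-- Pointwise truncated bound on the Taylor remainder of `x F(x) - F'(x)`. -/
lemma abs_mul_sub_deriv_sub_maclaurinSum_le {m : ℕ} {A B K : ℝ} {F : ℝ → ℝ}
    (hF : ContDiff ℝ (m + 2 : ℕ) F) (hA : ∀ x, |iteratedDeriv (m + 1) F x| ≤ A)
    (hB : ∀ x, |iteratedDeriv (m + 2) F x| ≤ B) (hK : 1 ≤ K) (x : ℝ) :
    |x * (F x - maclaurinSum F (m + 2) x)| + |deriv F x - maclaurinSum (deriv F) (m + 1) x| ≤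
      4 * A / m.factorial * {t : ℝ | K ≤ |t|}.indicator (fun t => |t| ^ (m + 2)) x +
        (B * K / (m + 2).factorial * |x| ^ (m + 2) + B / (m + 1).factorial * |x| ^ (m + 1)) := by
  have hF' : ContDiff ℝ (m + 1 : ℕ) (deriv F) := by
    have h : ContDiff ℝ (((m + 1 : ℕ) : WithTop ℕ∞) + 1) F := by exact_mod_cast hF
    exact (contDiff_succ_iff_deriv.1 h).2.2
  have hA0 : 0 ≤ A := (abs_nonneg _).trans (hA 0)
  have hB0 : 0 ≤ B := (abs_nonneg _).trans (hB 0)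
  have hx0 := abs_nonneg x
  rw [abs_mul]
  by_cases hx : K ≤ |x|
  · rw [Set.indicator_of_mem (by exact hx)]
    have h1 := abs_sub_maclaurinSum_succ_le (hF.of_le (by norm_cast; omega)) hA x
    have h2 := abs_sub_maclaurinSum_succ_le (n := m) (C := A)
      (hF'.of_le (by norm_cast; omega)) (by simpa [iteratedDeriv_succ'] using hA) x
    have hx1 : 1 ≤ |x| := hK.trans hx
    have f1 : 2 * A * |x| ^ (m + 1) / (m + 1).factorial ≤ 2 * A * |x| ^ (m + 1) / m.factorial := by
      gcongr
      omega
    have f2 : 2 * A * |x| ^ m / m.factorial ≤ 2 * A * |x| ^ (m + 2) / m.factorial := by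
      gcongr
      simp
    have f3 := mul_le_mul_of_nonneg_left (h1.trans f1) hx0
    have f4 : 0 ≤ B * K / (m + 2).factorial * |x| ^ (m + 2) +
      B / (m + 1).factorial * |x| ^ (m + 1) := by positivity
    have f5 : |x| * (2 * A * |x| ^ (m + 1) / m.factorial) =
        2 * A * |x| ^ (m + 2) / m.factorial := by ring
    have f6 : 4 * A / m.factorial * |x| ^ (m + 2) =
      2 * A * |x| ^ (m + 2) / m.factorial + 2 * A * |x| ^ (m + 2) / m.factorial := by ring
    linarith
  · rw [Set.indicator_of_notMem (by exact hx), mul_zero, zero_add]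
    have h1 := abs_sub_maclaurinSum_le hF hB x
    have h2 := abs_sub_maclaurinSum_le (n := m + 1) (C := B) hF'
      (by simpa [iteratedDeriv_succ'] using hB) x
    have f3 : |x| * |F x - maclaurinSum F (m + 2) x| ≤
        K * (B * |x| ^ (m + 2) / (m + 2).factorial) :=
      mul_le_mul (not_le.1 hx).le h1 (abs_nonneg _) (by linarith)
    refine (add_le_add f3 h2).trans (le_of_eq ?_)
    ring

/-- **Approximate integration by parts (truncated form).**
If the first `k ≥ 2` moments of `y` match those of a standard Gaussian, `F` is
`(k+1)`-times continuously differentiable with bounded `(k-1)`-th and `k`-th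
derivatives, then for every `K ≥ 1`,
`|E[y F(y)] − E[F'(y)]| ≤ (4‖F^{(k-1)}‖_∞/(k−2)!)·E[|y|^k; |y| ≥ K]
  + ((k+1)K/k!)·‖F^{(k)}‖_∞·E[|y|^k]`. -/
theorem approx_integration_by_parts_truncated
    {Ω : Type*} [MeasurableSpace Ω] (P : Measure Ω) [IsProbabilityMeasure P]
    (y : Ω → ℝ) (hy : Measurable y)
    (k : ℕ) (hk : 2 ≤ k)
    (hmom : ∀ j : ℕ, 1 ≤ j → j ≤ k →
      Integrable (fun ω => (y ω) ^ j) P ∧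
        ∫ ω, (y ω) ^ j ∂P = ∫ x, x ^ j ∂(gaussianReal 0 1))
    (F : ℝ → ℝ) (hF : ContDiff ℝ ((k : ℕ∞) + 1) F)
    (hbdd1 : BddAbove (Set.range fun x => |iteratedDeriv (k - 1) F x|))
    (hbdd2 : BddAbove (Set.range fun x => |iteratedDeriv k F x|))
    (K : ℝ) (hK : 1 ≤ K) :
    |(∫ ω, y ω * F (y ω) ∂P) - ∫ ω, deriv F (y ω) ∂P| ≤
      4 * (⨆ x, |iteratedDeriv (k - 1) F x|) / (k - 2).factorial *
          ∫ ω in {ω | K ≤ |y ω|}, |y ω| ^ k ∂P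
        + ((k : ℝ) + 1) * K / k.factorial * (⨆ x, |iteratedDeriv k F x|) *
          ∫ ω, |y ω| ^ k ∂P := by
  obtain ⟨m, rfl⟩ : ∃ m, k = m + 2 := ⟨k - 2, by omega⟩
  have hF2 : ContDiff ℝ (m + 2 : ℕ) F := hF.of_le le_self_add
  simp only [show m + 2 - 1 = m + 1 by omega, show m + 2 - 2 = m by omega] at hbdd1 ⊢
  set A := ⨆ x, |iteratedDeriv (m + 1) F x|
  set B := ⨆ x, |iteratedDeriv (m + 2) F x|
  have hA : ∀ x, |iteratedDeriv (m + 1) F x| ≤ A := fun x => le_ciSup hbdd1 x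
  have hB : ∀ x, |iteratedDeriv (m + 2) F x| ≤ B := fun x => le_ciSup hbdd2 x
  have hB0 : 0 ≤ B := (abs_nonneg _).trans (hB 0)
  have hint : ∀ j ≤ m + 2, Integrable (fun ω => y ω ^ j) P := by
    intro j hj
    rcases Nat.eq_zero_or_pos j with rfl | h
    · simp
    · exact (hmom j h hj).1
  have habs : ∀ j ≤ m + 2, Integrable (fun ω => |y ω| ^ j) P := by
    intro j hj
    simpa using (hint j hj).norm
  have hmom' : ∀ j ≤ m + 2, ∫ ω, y ω ^ j ∂P = ∫ x, x ^ j ∂(gaussianReal 0 1) := by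
    intro j hj
    rcases Nat.eq_zero_or_pos j with rfl | h
    · simp
    · exact (hmom j h hj).2
  have h1 : ∫ ω, y ω ∂P = 0 := by
    simpa using hmom' 1 (by omega)
  have h2 : ∫ ω, y ω ^ 2 ∂P = 1 := by
    rw [hmom' 2 (by omega), integral_pow_add_two_gaussianReal 0]
    simp
  have hibp := integral_mul_maclaurinSum_eq (F := F) (n := m + 1) hint h1 fun j hj => by
    rw [hmom' (j + 2) (by omega), hmom' j (by omega), integral_pow_add_two_gaussianReal]
  have ip := integrable_mul_maclaurinSum (F := F) (n := m + 2) hint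
  have ip' := integrable_maclaurinSum (F := deriv F) (n := m + 1) fun j hj => hint j (by omega)
  set S : Set Ω := {ω | K ≤ |y ω|}
  have hSm : MeasurableSet S := measurableSet_le measurable_const (by fun_prop)
  set b : Ω → ℝ := fun ω => 4 * A / m.factorial * S.indicator (fun ω => |y ω| ^ (m + 2)) ω +
    (B * K / (m + 2).factorial * |y ω| ^ (m + 2) +
      B / (m + 1).factorial * |y ω| ^ (m + 1)) with hb
  have i1 : Integrable (fun ω => 4 * A / m.factorial *
      S.indicator (fun ω => |y ω| ^ (m + 2)) ω) P :=
    ((habs (m + 2) le_rfl).indicator hSm).const_mul _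
  have i2 := (habs (m + 2) le_rfl).const_mul (B * K / (m + 2).factorial)
  have i3 := (habs (m + 1) (by omega)).const_mul (B / (m + 1).factorial)
  have i23 : Integrable (fun ω => B * K / (m + 2).factorial * |y ω| ^ (m + 2) +
      B / (m + 1).factorial * |y ω| ^ (m + 1)) P := i2.add i3
  have ib : Integrable b P := i1.add i23
  have hbound : ∀ ω, |y ω * (F (y ω) - maclaurinSum F (m + 2) (y ω))| +
      |deriv F (y ω) - maclaurinSum (deriv F) (m + 1) (y ω)| ≤ b ω := fun ω =>
    abs_mul_sub_deriv_sub_maclaurinSum_le hF2 hA hB hK (y ω)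
  have hFm : Measurable F := hF2.continuous.measurable
  have mp : ∀ (G : ℝ → ℝ) n, Measurable (maclaurinSum G n) := fun G n => by
    unfold maclaurinSum
    fun_prop
  have iR : Integrable (fun ω => y ω * (F (y ω) - maclaurinSum F (m + 2) (y ω))) P :=
    ib.mono' (hy.mul ((hFm.comp hy).sub ((mp _ _).comp hy))).aestronglyMeasurable
      (ae_of_all _ fun ω => (le_add_of_nonneg_right (abs_nonneg _)).trans (hbound ω))
  have iR' : Integrable (fun ω => deriv F (y ω) - maclaurinSum (deriv F) (m + 1) (y ω)) P :=
    ib.mono' (((measurable_deriv F).comp hy).sub ((mp _ _).comp hy)).aestronglyMeasurable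
      (ae_of_all _ fun ω => (le_add_of_nonneg_left (abs_nonneg _)).trans (hbound ω))
  have e1 : ∫ ω, y ω * F (y ω) ∂P =
      ∫ ω, y ω * (F (y ω) - maclaurinSum F (m + 2) (y ω)) ∂P +
        ∫ ω, y ω * maclaurinSum F (m + 2) (y ω) ∂P := by
    rw [← integral_add iR ip]
    exact integral_congr_ae (ae_of_all _ fun ω => by ring)
  have e2 : ∫ ω, deriv F (y ω) ∂P =
      ∫ ω, (deriv F (y ω) - maclaurinSum (deriv F) (m + 1) (y ω)) ∂P +
        ∫ ω, maclaurinSum (deriv F) (m + 1) (y ω) ∂P := by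
    rw [← integral_add iR' ip']
    exact integral_congr_ae (ae_of_all _ fun ω => by ring)
  have hle : |(∫ ω, y ω * F (y ω) ∂P) - ∫ ω, deriv F (y ω) ∂P| ≤ ∫ ω, b ω ∂P := by
    rw [e1, e2, hibp, add_sub_add_right_eq_sub, ← integral_sub iR iR']
    refine abs_integral_le_integral_abs.trans (integral_mono (iR.sub iR').abs ib fun ω => ?_)
    exact (abs_sub _ _).trans (hbound ω)
  have hbint : ∫ ω, b ω ∂P = 4 * A / m.factorial * ∫ ω in S, |y ω| ^ (m + 2) ∂P +
      (B * K / (m + 2).factorial * ∫ ω, |y ω| ^ (m + 2) ∂P +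
        B / (m + 1).factorial * ∫ ω, |y ω| ^ (m + 1) ∂P) := by
    simp only [hb]
    rw [integral_add i1 i23, integral_add i2 i3, integral_const_mul,
      integral_const_mul, integral_const_mul, integral_indicator hSm]
  have hcmp : ∫ ω, |y ω| ^ (m + 1) ∂P ≤ ∫ ω, |y ω| ^ (m + 2) ∂P := by
    rw [← sub_nonneg, ← integral_sub (habs _ le_rfl) (habs _ (by omega))]
    have h0 : ∫ ω, (y ω ^ 2 - 1) / 2 ∂P = 0 := by
      rw [integral_div, integral_sub (hint 2 (by omega)) (integrable_const _), h2]
      simp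
    rw [← h0]
    refine integral_mono (((hint 2 (by omega)).sub (integrable_const _)).div_const _)
      ((habs _ le_rfl).sub (habs _ (by omega))) fun ω => ?_
    simpa using half_sq_sub_one_le_pow_sub_pow (abs_nonneg (y ω)) m
  have hM0 : 0 ≤ ∫ ω, |y ω| ^ (m + 2) ∂P := integral_nonneg fun ω => by positivity
  have hlast : B / (m + 1).factorial * ∫ ω, |y ω| ^ (m + 1) ∂P ≤
      B / (m + 1).factorial * (K * ∫ ω, |y ω| ^ (m + 2) ∂P) := by
    gcongr
    nlinarith
  rw [hbint] at hle
  refine hle.trans (add_le_add le_rfl ((add_le_add le_rfl hlast).trans (le_of_eq ?_)))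
  have : ((m + 1).factorial : ℝ) ≠ 0 := by positivity
  simp only [Nat.factorial_succ (m + 1)]
  push_cast
  field_simp
  ring
end

section
/- Let y be a real random variable whose first k moments (k ≥ 2) match those of a standard Gaussian random variable, and assume in addition E[|y|^{k+1}] < ∞. Let F : ℝ → ℝ be (k+1)-times continuously differentiable with ‖F^{(k-1)}‖_∞ < ∞ and ‖F^{(k)}‖_∞ < ∞. Then |E[y F(y)] − E[F'(y)]| ≤ ((k+1)/k!) · ‖F^{(k)}‖_∞ · E[|y|^{k+1}]. -/
open MeasureTheory ProbabilityTheory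

lemma hasDerivAt_gaussianPDFReal_zero_one (x : ℝ) :
    HasDerivAt (gaussianPDFReal 0 1) (-(x * gaussianPDFReal 0 1 x)) x := by
  have h : HasDerivAt (fun x : ℝ => -(x - 0) ^ 2 / (2 * ((1 : NNReal) : ℝ))) (-x) x := by
    have h0 := ((hasDerivAt_id x).sub_const 0).pow 2 |>.neg.div_const (2 * ((1 : NNReal) : ℝ))
    convert! h0 using 1
    simp only [NNReal.coe_one, id]
    ring
  rw [gaussianPDFReal_def]
  convert! h.exp.const_mul ((√(2 * Real.pi * ((1 : NNReal) : ℝ)))⁻¹) using 1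
  ring

lemma integrable_pow_mul_gaussianPDFReal (n : ℕ) :
    Integrable (fun x : ℝ => x ^ n * gaussianPDFReal 0 1 x) := by
  have h := integrable_pow_gaussianReal n
  rw [gaussianReal_of_var_ne_zero _ one_ne_zero, integrable_withDensity_iff_integrable_smul'
    (measurable_gaussianPDF 0 1) (ae_of_all _ fun _ => gaussianPDF_lt_top)] at h
  simpa [toReal_gaussianPDF, mul_comm] using h

/-- Maclaurin expansion with the remainder controlled by a global bound on the derivative. -/
lemma abs_sub_sum_iteratedDeriv_le {f : ℝ → ℝ} {n : ℕ} {M : ℝ} (hf : ContDiff ℝ (n + 1) f)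
    (hM : ∀ x, |iteratedDeriv (n + 1) f x| ≤ M) (x : ℝ) :
    |f x - ∑ j ∈ Finset.range (n + 1), iteratedDeriv j f 0 / j.factorial * x ^ j| ≤
      M / (n + 1).factorial * |x| ^ (n + 1) := by
  have hM0 : 0 ≤ M := (abs_nonneg _).trans (hM 0)
  rcases eq_or_ne 0 x with rfl | hx
  · rw [Finset.sum_range_succ']
    simp
  · obtain ⟨z, -, hz⟩ := taylor_mean_remainder_lagrange_iteratedDeriv hx hf.contDiffOn
    have ht : taylorWithinEval f n (Set.uIcc 0 x) 0 x =
        ∑ j ∈ Finset.range (n + 1), iteratedDeriv j f 0 / j.factorial * x ^ j := by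
      rw [taylor_within_apply]
      refine Finset.sum_congr rfl fun j hj => ?_
      rw [iteratedDerivWithin_eq_iteratedDeriv (uniqueDiffOn_uIcc hx)
        ((hf.of_le (by
          have := Finset.mem_range.mp hj
          exact_mod_cast this.le)).contDiffAt) Set.left_mem_uIcc]
      simp only [sub_zero, smul_eq_mul]
      ring
    rw [← ht, hz, sub_zero, abs_div, abs_mul, abs_pow, Nat.abs_cast, div_mul_eq_mul_div]
    gcongr
    exact hM z

lemma integral_abs_pow_le_integral_abs_pow_add_two {Ω : Type*} [MeasurableSpace Ω]
    {P : Measure Ω} [IsProbabilityMeasure P] {y : Ω → ℝ} {n : ℕ}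
    (hn : Integrable (fun ω => |y ω| ^ n) P) (hn2 : Integrable (fun ω => |y ω| ^ (n + 2)) P)
    (h2 : Integrable (fun ω => y ω ^ 2) P) (hvar : ∫ ω, y ω ^ 2 ∂P = 1) :
    ∫ ω, |y ω| ^ n ∂P ≤ ∫ ω, |y ω| ^ (n + 2) ∂P := by
  have key (t : ℝ) : t ^ 2 - 1 ≤ |t| ^ (n + 2) - |t| ^ n := by
    rw [← sq_abs t]
    have h0 := abs_nonneg t
    rcases le_total |t| 1 with h | h
    · nlinarith [pow_le_one₀ h0 h (n := n), sq_nonneg t, pow_le_one₀ h0 h (n := 2),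
        mul_nonneg (sub_nonneg.2 (pow_le_one₀ h0 h (n := n)))
          (sub_nonneg.2 (pow_le_one₀ h0 h (n := 2))), pow_add |t| n 2]
    · nlinarith [mul_nonneg (sub_nonneg.2 (one_le_pow₀ h (n := n)))
          (sub_nonneg.2 (one_le_pow₀ h (n := 2))), pow_add |t| n 2]
  have h := integral_mono (h2.sub (integrable_const 1)) (hn2.sub hn) fun ω => key (y ω)
  simp only [Pi.sub_apply] at h
  rw [integral_sub h2 (integrable_const 1), integral_sub hn2 hn, hvar] at h
  simp at h
  linarith

/-- If `f` is within an integrable error `h` of an integrable function `g`, then their integrals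
differ by at most the integral of `h`. -/
lemma abs_integral_sub_integral_le {Ω : Type*} [MeasurableSpace Ω] {P : Measure Ω}
    {f g h : Ω → ℝ} (hf : AEStronglyMeasurable f P) (hg : Integrable g P) (hh : Integrable h P)
    (hfg : ∀ ω, |f ω - g ω| ≤ h ω) :
    |∫ ω, f ω ∂P - ∫ ω, g ω ∂P| ≤ ∫ ω, h ω ∂P := by
  have hr : Integrable (fun ω => f ω - g ω) P :=
    hh.mono' (hf.sub hg.1) (ae_of_all _ hfg)
  have hfi : Integrable f P := (hr.add hg).congr (ae_of_all _ fun ω => by simp)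
  rw [← integral_sub hfi hg]
  exact norm_integral_le_of_norm_le (f := fun ω => f ω - g ω) hh (ae_of_all _ hfg)

/-- **Approximate integration by parts (moment form).**
If the first `k ≥ 2` moments of `y` match those of a standard Gaussian,
`E[|y|^{k+1}] < ∞`, and `F` is `(k+1)`-times continuously differentiable with
bounded `(k-1)`-th and `k`-th derivatives, then
`|E[y F(y)] − E[F'(y)]| ≤ ((k+1)/k!)·‖F^{(k)}‖_∞·E[|y|^{k+1}]`. -/
theorem approx_integration_by_parts
    {Ω : Type*} [MeasurableSpace Ω] (P : Measure Ω) [IsProbabilityMeasure P]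
    (y : Ω → ℝ) (hy : Measurable y)
    (k : ℕ) (hk : 2 ≤ k)
    (hmom : ∀ j : ℕ, 1 ≤ j → j ≤ k →
      Integrable (fun ω => (y ω) ^ j) P ∧
        ∫ ω, (y ω) ^ j ∂P = ∫ x, x ^ j ∂(gaussianReal 0 1))
    (hint : Integrable (fun ω => |y ω| ^ (k + 1)) P)
    (F : ℝ → ℝ) (hF : ContDiff ℝ ((k : ℕ∞) + 1) F)
    (hbdd1 : BddAbove (Set.range fun x => |iteratedDeriv (k - 1) F x|))
    (hbdd2 : BddAbove (Set.range fun x => |iteratedDeriv k F x|)) :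
    |(∫ ω, y ω * F (y ω) ∂P) - ∫ ω, deriv F (y ω) ∂P| ≤
      ((k : ℝ) + 1) / k.factorial * (⨆ x, |iteratedDeriv k F x|) *
        ∫ ω, |y ω| ^ (k + 1) ∂P := by
  obtain ⟨n, rfl⟩ := Nat.exists_eq_add_of_le' hk
  set M := ⨆ x, |iteratedDeriv (n + 2) F x|
  have hM (x : ℝ) : |iteratedDeriv (n + 2) F x| ≤ M := le_ciSup hbdd2 x
  have hM0 : 0 ≤ M := (abs_nonneg _).trans (hM 0)
  have hF2 : ContDiff ℝ (n + 1 + 1) F := hF.of_le (by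
    norm_cast
    omega)
  have hF' : ContDiff ℝ (n + 1) (deriv F) := (contDiff_succ_iff_deriv.mp hF2).2.2
  have hpow (j : ℕ) (hj : j ≤ n + 2) : Integrable (fun ω => y ω ^ j) P ∧
      ∫ ω, y ω ^ j ∂P = ∫ x, x ^ j ∂(gaussianReal 0 1) := by
    rcases Nat.eq_zero_or_pos j with rfl | h
    · simp
    · exact hmom j h hj
  have habs (j : ℕ) (hj : j ≤ n + 2) : Integrable (fun ω => |y ω| ^ j) P := by
    simpa using (hpow j hj).1.abs
  have hvar : ∫ ω, y ω ^ 2 ∂P = 1 := by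
    rw [(hpow 2 (by omega)).2, integral_pow_add_two_gaussianReal 0]
    simp
  have hmean : ∫ ω, y ω ∂P = 0 := by
    have h := (hpow 1 (by omega)).2
    simp only [pow_one] at h
    rw [h, integral_id_gaussianReal]
  let a (j : ℕ) : ℝ := iteratedDeriv j F 0
  have hR (x : ℝ) := abs_sub_sum_iteratedDeriv_le (n := n + 1) (by exact_mod_cast hF2) hM x
  have hR' (x : ℝ) := abs_sub_sum_iteratedDeriv_le (n := n) (M := M) hF'
    (fun z => by rw [← iteratedDeriv_succ']; exact hM z) x
  simp only [← iteratedDeriv_succ'] at hR'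
  have hpoly_int : ∀ j ∈ Finset.range (n + 2),
      Integrable (fun ω => a j / j.factorial * y ω ^ (j + 1)) P := fun j hj =>
    (hpow (j + 1) (by have := Finset.mem_range.mp hj; omega)).1.const_mul _
  have hpoly'_int : ∀ j ∈ Finset.range (n + 1),
      Integrable (fun ω => a (j + 1) / j.factorial * y ω ^ j) P := fun j hj =>
    (hpow j (by have := Finset.mem_range.mp hj; omega)).1.const_mul _
  have h1 := abs_integral_sub_integral_le (P := P)
    (f := fun ω => y ω * F (y ω))
    (g := fun ω => ∑ j ∈ Finset.range (n + 2), a j / j.factorial * y ω ^ (j + 1))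
    (h := fun ω => M / (n + 2).factorial * |y ω| ^ (n + 2 + 1))
    (hy.mul (hF.continuous.measurable.comp hy)).aestronglyMeasurable
    (integrable_finsetSum _ hpoly_int) (hint.const_mul _) (fun ω => by
      have h : y ω * F (y ω) - ∑ j ∈ Finset.range (n + 2), a j / j.factorial * y ω ^ (j + 1) =
          y ω * (F (y ω) - ∑ j ∈ Finset.range (n + 2), a j / j.factorial * y ω ^ j) := by
        rw [mul_sub, Finset.mul_sum]
        congr 1
        exact Finset.sum_congr rfl fun j _ => by ring
      rw [h, abs_mul]
      refine (mul_le_mul_of_nonneg_left (hR (y ω)) (abs_nonneg _)).trans_eq ?_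
      ring)
  have h2 := abs_integral_sub_integral_le (P := P)
    (f := fun ω => deriv F (y ω))
    (g := fun ω => ∑ j ∈ Finset.range (n + 1), a (j + 1) / j.factorial * y ω ^ j)
    (h := fun ω => M / (n + 1).factorial * |y ω| ^ (n + 1))
    (hF'.continuous.measurable.comp hy).aestronglyMeasurable
    (integrable_finsetSum _ hpoly'_int) ((habs (n + 1) (by omega)).const_mul _)
    (fun ω => hR' (y ω))
  have hpoly : ∫ ω, ∑ j ∈ Finset.range (n + 2), a j / j.factorial * y ω ^ (j + 1) ∂P =
      ∫ ω, ∑ j ∈ Finset.range (n + 1), a (j + 1) / j.factorial * y ω ^ j ∂P := by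
    rw [integral_finsetSum _ hpoly_int, integral_finsetSum _ hpoly'_int, Finset.sum_range_succ']
    simp only [integral_const_mul, zero_add, pow_one, hmean, mul_zero, add_zero]
    refine Finset.sum_congr rfl fun j hj => ?_
    have := Finset.mem_range.mp hj
    rw [(hpow (j + 1 + 1) (by omega)).2, (hpow j (by omega)).2,
      integral_pow_add_two_gaussianReal j, Nat.factorial_succ]
    push_cast
    field_simp
  have h3 := integral_abs_pow_le_integral_abs_pow_add_two (habs (n + 1) (by omega)) hint
    (hpow 2 (by omega)).1 hvar
  rw [integral_const_mul] at h1 h2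
  rw [hpoly] at h1
  have h4 := mul_le_mul_of_nonneg_left h3 (by positivity : 0 ≤ M / (n + 1).factorial)
  have hfac : M / (n + 1).factorial = (n + 2) * (M / (n + 2).factorial) := by
    rw [Nat.factorial_succ (n + 1)]
    push_cast
    field_simp
    ring
  calc _ ≤ M / (n + 2).factorial * ∫ ω, |y ω| ^ (n + 2 + 1) ∂P +
        M / (n + 1).factorial * ∫ ω, |y ω| ^ (n + 2 + 1) ∂P := by
        rw [abs_le] at h1 h2 ⊢
        constructor <;> linarith [h1.1, h1.2, h2.1, h2.2, h4]
    _ = _ := by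
        rw [hfac]
        push_cast
        ring
end

section
/- Let ν be a finite positive measure on a nonempty finite set Σ, let f : Σ → ℝ with |f| ≤ 1, let n ≥ 1, and let L : Σ^n → ℝ with ‖L‖_∞ ≤ 1. For x ∈ ℝ and γ ≥ 0 define the Gibbs measure G_x(σ) = exp(γ x f(σ)) ν(σ)/Z_x where Z_x = Σ_σ exp(γ x f(σ)) ν(σ), and let ⟨L⟩_x denote the expectation of L under the n-fold product measure G_x^{⊗n}. Then for every k ≥ 1 and every x ∈ ℝ, |d^k/dx^k ⟨L⟩_x| ≤ γ^k · 2^{k(k+1)/2} · n^k. -/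
open MeasureTheory

/-- The weight of `s` under the Gibbs measure with external field `γ * t`. -/
noncomputable def gibbsWeight {S : Type*} [Fintype S] (ν f : S → ℝ) (γ t : ℝ) (s : S) : ℝ :=
  Real.exp (γ * t * f s) * ν s / ∑ τ, Real.exp (γ * t * f τ) * ν τ

/-- The average of a function of `n` independent replicas under the Gibbs measure. -/
noncomputable def gibbsAverage {S : Type*} [Fintype S] (ν f : S → ℝ) (γ : ℝ) {n : ℕ}
    (L : (Fin n → S) → ℝ) (t : ℝ) : ℝ :=
  ∑ σ : Fin n → S, L σ * ∏ l, gibbsWeight ν f γ t (σ l)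

/-- The function of `n + 1` replicas whose Gibbs average is the derivative of that of `L`. -/
def replicaDeriv {S : Type*} (f : S → ℝ) (γ : ℝ) {n : ℕ} (L : (Fin n → S) → ℝ)
    (ρ : Fin (n + 1) → S) : ℝ :=
  L (Fin.tail ρ) * ∑ l, γ * (f (Fin.tail ρ l) - f (ρ 0))

lemma abs_replicaDeriv_le {S : Type*} {f : S → ℝ} {γ : ℝ} {n : ℕ} (hf : ∀ σ, |f σ| ≤ 1) (hγ : 0 ≤ γ)
    {L : (Fin n → S) → ℝ} {M : ℝ} (hL : ∀ σ, |L σ| ≤ M) (ρ : Fin (n + 1) → S) :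
    |replicaDeriv f γ L ρ| ≤ M * (2 * γ * n) := by
  have hsum : |∑ l, γ * (f (Fin.tail ρ l) - f (ρ 0))| ≤ 2 * γ * n := by
    calc |∑ l, γ * (f (Fin.tail ρ l) - f (ρ 0))|
        ≤ ∑ l, |γ * (f (Fin.tail ρ l) - f (ρ 0))| := Finset.abs_sum_le_sum_abs _ _
      _ ≤ ∑ _l : Fin n, 2 * γ := by
          refine Finset.sum_le_sum fun l _ => ?_
          rw [abs_mul, abs_of_nonneg hγ, mul_comm]
          refine mul_le_mul_of_nonneg_right ?_ hγ
          linarith [abs_sub (f (Fin.tail ρ l)) (f (ρ 0)), hf (Fin.tail ρ l), hf (ρ 0)]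
      _ = 2 * γ * n := by simp [mul_comm]
  rw [replicaDeriv, abs_mul]
  exact mul_le_mul (hL _) hsum (abs_nonneg _) ((abs_nonneg _).trans (hL (Fin.tail ρ)))

section Gibbs

variable {S : Type*} [Fintype S] {ν f : S → ℝ} {γ : ℝ} {n : ℕ}

lemma gibbs_partition_pos (hν : ∀ σ, 0 ≤ ν σ) (hνtot : 0 < ∑ σ, ν σ) (t : ℝ) :
    0 < ∑ τ, Real.exp (γ * t * f τ) * ν τ := by
  obtain ⟨s, hs, hs'⟩ := (Finset.sum_pos_iff_of_nonneg fun τ _ => hν τ).1 hνtot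
  exact Finset.sum_pos' (fun τ _ => mul_nonneg (Real.exp_pos _).le (hν τ))
    ⟨s, hs, mul_pos (Real.exp_pos _) hs'⟩

lemma gibbsWeight_nonneg (hν : ∀ σ, 0 ≤ ν σ) (t : ℝ) (s : S) : 0 ≤ gibbsWeight ν f γ t s :=
  div_nonneg (mul_nonneg (Real.exp_pos _).le (hν s))
    (Finset.sum_nonneg fun τ _ => mul_nonneg (Real.exp_pos _).le (hν τ))

lemma sum_gibbsWeight (hν : ∀ σ, 0 ≤ ν σ) (hνtot : 0 < ∑ σ, ν σ) (t : ℝ) :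
    ∑ s, gibbsWeight ν f γ t s = 1 := by
  simp only [gibbsWeight]
  rw [← Finset.sum_div, div_self (gibbs_partition_pos hν hνtot t).ne']

lemma sum_prod_gibbsWeight (hν : ∀ σ, 0 ≤ ν σ) (hνtot : 0 < ∑ σ, ν σ) (t : ℝ) :
    ∑ σ : Fin n → S, ∏ l, gibbsWeight ν f γ t (σ l) = 1 := by
  classical
  rw [← Fintype.sum_pow, sum_gibbsWeight hν hνtot, one_pow]

lemma abs_gibbsAverage_le (hν : ∀ σ, 0 ≤ ν σ) (hνtot : 0 < ∑ σ, ν σ)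
    {L : (Fin n → S) → ℝ} {M : ℝ} (hL : ∀ σ, |L σ| ≤ M) (t : ℝ) :
    |gibbsAverage ν f γ L t| ≤ M := by
  have hprod (σ : Fin n → S) : 0 ≤ ∏ l, gibbsWeight ν f γ t (σ l) :=
    Finset.prod_nonneg fun l _ => gibbsWeight_nonneg hν t (σ l)
  calc |gibbsAverage ν f γ L t|
      ≤ ∑ σ : Fin n → S, |L σ * ∏ l, gibbsWeight ν f γ t (σ l)| :=
        Finset.abs_sum_le_sum_abs _ _
    _ ≤ ∑ σ : Fin n → S, M * ∏ l, gibbsWeight ν f γ t (σ l) := by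
        refine Finset.sum_le_sum fun σ _ => ?_
        rw [abs_mul, abs_of_nonneg (hprod σ)]
        exact mul_le_mul_of_nonneg_right (hL σ) (hprod σ)
    _ = M := by rw [← Finset.mul_sum, sum_prod_gibbsWeight hν hνtot, mul_one]

lemma hasDerivAt_gibbsWeight (hν : ∀ σ, 0 ≤ ν σ) (hνtot : 0 < ∑ σ, ν σ) (t : ℝ) (s : S) :
    HasDerivAt (fun t => gibbsWeight ν f γ t s)
      (γ * (f s - ∑ τ, f τ * gibbsWeight ν f γ t τ) * gibbsWeight ν f γ t s) t := by
  have hZ := (gibbs_partition_pos (f := f) (γ := γ) hν hνtot t).ne'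
  have hnum (τ : S) : HasDerivAt (fun t => Real.exp (γ * t * f τ) * ν τ)
      (γ * (f τ * (Real.exp (γ * t * f τ) * ν τ))) t := by
    have h := ((((hasDerivAt_id t).const_mul γ).mul_const (f τ)).exp).mul_const (ν τ)
    refine h.congr_deriv ?_
    simp only [id]
    ring
  have hsum := HasDerivAt.fun_sum (u := Finset.univ) fun τ _ => hnum τ
  refine ((hnum s).fun_div hsum hZ).congr_deriv ?_
  simp only [gibbsWeight, ← mul_div_assoc, ← Finset.sum_div, ← Finset.mul_sum]
  field_simp

lemma hasDerivAt_gibbsAverage (hν : ∀ σ, 0 ≤ ν σ) (hνtot : 0 < ∑ σ, ν σ)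
    (L : (Fin n → S) → ℝ) (t : ℝ) :
    HasDerivAt (gibbsAverage ν f γ L) (gibbsAverage ν f γ (replicaDeriv f γ L) t) t := by
  have hprod (σ : Fin n → S) := HasDerivAt.fun_finsetProd (u := Finset.univ)
    fun l _ => hasDerivAt_gibbsWeight (f := f) (γ := γ) hν hνtot t (σ l)
  refine (HasDerivAt.fun_sum (u := Finset.univ)
    fun σ _ => (hprod σ).const_mul (L σ)).congr_deriv ?_
  rw [gibbsAverage, ← (Fin.consEquiv fun _ => S).sum_comp, Fintype.sum_prod_type_right]
  refine Finset.sum_congr rfl fun σ _ => ?_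
  have hreplica (l : Fin n) : f (σ l) - ∑ τ, f τ * gibbsWeight ν f γ t τ =
      ∑ τ, (f (σ l) - f τ) * gibbsWeight ν f γ t τ := by
    simp only [sub_mul, Finset.sum_sub_distrib]
    rw [← Finset.mul_sum, sum_gibbsWeight hν hνtot, mul_one]
  have hterm (l : Fin n) : (∏ j ∈ Finset.univ.erase l, gibbsWeight ν f γ t (σ j)) •
        (γ * (f (σ l) - ∑ τ, f τ * gibbsWeight ν f γ t τ) * gibbsWeight ν f γ t (σ l)) =
      ∑ τ, γ * (f (σ l) - f τ) * (gibbsWeight ν f γ t τ * ∏ j, gibbsWeight ν f γ t (σ j)) := by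
    rw [hreplica, ← Finset.prod_erase_mul _ _ (Finset.mem_univ l), smul_eq_mul,
      Finset.mul_sum, Finset.sum_mul, Finset.mul_sum]
    exact Finset.sum_congr rfl fun τ _ => by ring
  simp only [hterm]
  rw [Finset.sum_comm, Finset.mul_sum]
  refine Finset.sum_congr rfl fun τ _ => ?_
  have htail : Fin.tail (Fin.consEquiv (fun _ => S) (τ, σ)) = σ := rfl
  simp only [replicaDeriv, htail, Fin.consEquiv_apply, Fin.cons_zero, Fin.cons_succ,
    Fin.prod_univ_succ]
  rw [← Finset.sum_mul, mul_assoc]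

lemma abs_iteratedDeriv_gibbsAverage_le (hν : ∀ σ, 0 ≤ ν σ) (hνtot : 0 < ∑ σ, ν σ)
    (hf : ∀ σ, |f σ| ≤ 1) (hγ : 0 ≤ γ) (k : ℕ) (hn : 1 ≤ n)
    {L : (Fin n → S) → ℝ} {M : ℝ} (hM : 0 ≤ M) (hL : ∀ σ, |L σ| ≤ M) (x : ℝ) :
    |iteratedDeriv k (gibbsAverage ν f γ L) x| ≤
      M * (γ ^ k * 2 ^ (k * (k + 1) / 2) * (n : ℝ) ^ k) := by
  induction k generalizing n M with
  | zero => simpa using abs_gibbsAverage_le hν hνtot hL x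
  | succ k ih =>
    have hderiv : deriv (gibbsAverage ν f γ L) = gibbsAverage ν f γ (replicaDeriv f γ L) :=
      funext fun t => (hasDerivAt_gibbsAverage hν hνtot L t).deriv
    rw [iteratedDeriv_succ', hderiv]
    have hn' : ((n + 1 : ℕ) : ℝ) ≤ 2 * n := by
      exact_mod_cast (by omega : n + 1 ≤ 2 * n)
    have hexp : (k + 1) * (k + 1 + 1) / 2 = k * (k + 1) / 2 + (k + 1) := by
      rw [show (k + 1) * (k + 1 + 1) = k * (k + 1) + (k + 1) * 2 by ring,
        Nat.add_mul_div_right _ _ two_pos]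
    calc |iteratedDeriv k (gibbsAverage ν f γ (replicaDeriv f γ L)) x|
        ≤ M * (2 * γ * n) * (γ ^ k * 2 ^ (k * (k + 1) / 2) * ((n + 1 : ℕ) : ℝ) ^ k) :=
          ih (by omega) (by positivity) (abs_replicaDeriv_le hf hγ hL)
      _ ≤ M * (2 * γ * n) * (γ ^ k * 2 ^ (k * (k + 1) / 2) * (2 * (n : ℝ)) ^ k) := by
          gcongr
      _ = M * (γ ^ (k + 1) * 2 ^ ((k + 1) * (k + 1 + 1) / 2) * (n : ℝ) ^ (k + 1)) := by
          rw [hexp]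
          ring

end Gibbs

/-- **Derivative bounds for Gibbs averages.**
For the Gibbs measure `G_x(σ) = exp(γ x f(σ)) ν(σ)/Z_x` on a nonempty finite set,
the `k`-th derivative in `x` of the Gibbs average `⟨L⟩_x` of a function `L` of
`n` replicas with `‖L‖_∞ ≤ 1` is bounded by `γ^k · 2^{k(k+1)/2} · n^k`. -/
theorem gibbs_average_iteratedDeriv_bound
    {S : Type*} [Fintype S] [Nonempty S]
    (ν : S → ℝ) (hν : ∀ σ, 0 ≤ ν σ) (hνtot : 0 < ∑ σ, ν σ)
    (f : S → ℝ) (hf : ∀ σ, |f σ| ≤ 1)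
    (n : ℕ) (hn : 1 ≤ n)
    (L : (Fin n → S) → ℝ) (hL : ∀ σ, |L σ| ≤ 1)
    (γ : ℝ) (hγ : 0 ≤ γ)
    (k : ℕ) (hk : 1 ≤ k) (x : ℝ) :
    |iteratedDeriv k
        (fun t => ∑ σ : Fin n → S, L σ *
          ∏ ℓ, (Real.exp (γ * t * f (σ ℓ)) * ν (σ ℓ) /
            ∑ τ, Real.exp (γ * t * f τ) * ν τ)) x| ≤
      γ ^ k * 2 ^ (k * (k + 1) / 2) * (n : ℝ) ^ k := by
  simpa only [one_mul] using!
    abs_iteratedDeriv_gibbsAverage_le hν hνtot hf hγ k hn zero_le_one hL x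
end

section
/- For a random Gibbs measure on {−1,+1}^V over a finite vertex set V whose spin correlations satisfy the FKG inequality ⟨σ_i σ_j⟩ ≥ ⟨σ_i⟩⟨σ_j⟩ almost surely for all i, j ∈ V, the site overlap R_{1,2} := |V|^{−1} Σ_{i∈V} σ_i¹ σ_i² satisfies E⟨(R_{1,2} − ⟨R_{1,2}⟩)²⟩ ≤ 2 E⟨(m(σ) − ⟨m(σ)⟩)²⟩, where m(σ) = |V|^{−1} Σ_{i∈V} σ_i is the magnetization. -/
open MeasureTheory ProbabilityTheory

/-- The spin value `±1` of a Boolean spin. -/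
noncomputable def spin (b : Bool) : ℝ := if b then 1 else -1

section WeightedSums

variable {S ι : Type*} [Fintype S] [Fintype ι]

lemma sum_sub_mean_sq_mul_weight (f g : S → ℝ) (hg : ∑ s, g s = 1) :
    ∑ s, (f s - ∑ t, f t * g t) ^ 2 * g s = ∑ s, f s ^ 2 * g s - (∑ s, f s * g s) ^ 2 := by
  set M := ∑ t, f t * g t with hM
  have h : ∀ s, (f s - M) ^ 2 * g s = f s ^ 2 * g s - 2 * M * (f s * g s) + M ^ 2 * g s := by
    intro s; ring
  simp_rw [h, Finset.sum_add_distrib, Finset.sum_sub_distrib, ← Finset.mul_sum, hg, ← hM]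
  ring

lemma weighted_variance_sum (a : ι → S → ℝ) (g : S → ℝ) (hg : ∑ s, g s = 1) (c : ℝ) :
    ∑ s, (c * ∑ i, a i s - ∑ t, (c * ∑ i, a i t) * g t) ^ 2 * g s =
      c ^ 2 * ∑ i, ∑ j, ((∑ s, a i s * a j s * g s) -
        (∑ s, a i s * g s) * ∑ s, a j s * g s) := by
  rw [sum_sub_mean_sq_mul_weight _ g hg]
  have h1 : ∑ s, (c * ∑ i, a i s) * g s = c * ∑ i, ∑ s, a i s * g s := by
    rw [Finset.sum_comm, Finset.mul_sum]
    exact Finset.sum_congr rfl fun s _ => by rw [← Finset.sum_mul]; ring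
  have h2 : ∑ s, (c * ∑ i, a i s) ^ 2 * g s = c ^ 2 * ∑ i, ∑ j, ∑ s, a i s * a j s * g s := by
    have h : ∀ i, ∑ j, ∑ s, a i s * a j s * g s = ∑ s, ∑ j, a i s * a j s * g s :=
      fun i => Finset.sum_comm
    simp_rw [h]
    rw [Finset.sum_comm, Finset.mul_sum]
    refine Finset.sum_congr rfl fun s _ => ?_
    simp_rw [← Finset.sum_mul]
    rw [← Finset.sum_mul_sum]
    ring
  rw [h1, h2]
  simp_rw [Finset.sum_sub_distrib]
  rw [← Finset.sum_mul_sum]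
  ring

lemma weighted_variance_overlap (a : ι → S → ℝ) (g : S → ℝ) (hg : ∑ s, g s = 1) (c : ℝ) :
    ∑ s₁, ∑ s₂, (c * ∑ i, a i s₁ * a i s₂ -
        ∑ t₁, ∑ t₂, (c * ∑ i, a i t₁ * a i t₂) * g t₁ * g t₂) ^ 2 * g s₁ * g s₂ =
      c ^ 2 * ∑ i, ∑ j, ((∑ s, a i s * a j s * g s) ^ 2 -
        ((∑ s, a i s * g s) * ∑ s, a j s * g s) ^ 2) := by
  have hg2 : ∑ p : S × S, g p.1 * g p.2 = 1 := by
    rw [Fintype.sum_prod_type, ← Finset.sum_mul_sum, hg, one_mul]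
  have key := weighted_variance_sum (fun i (p : S × S) => a i p.1 * a i p.2)
    (fun p => g p.1 * g p.2) hg2 c
  simp only [Fintype.sum_prod_type, ← mul_assoc] at key
  rw [key]
  congr 1
  refine Finset.sum_congr rfl fun i _ => Finset.sum_congr rfl fun j _ => ?_
  have h : ∀ b : S → ℝ, ∑ s, ∑ t, b s * b t * g s * g t = (∑ s, b s * g s) ^ 2 := fun b => by
    rw [sq, Finset.sum_mul_sum]
    exact Finset.sum_congr rfl fun s _ => Finset.sum_congr rfl fun t _ => by ring
  rw [h, h, mul_pow, ← h fun s => a i s * a j s]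
  congr 1
  refine Finset.sum_congr rfl fun s _ => Finset.sum_congr rfl fun t _ => ?_
  ring

lemma abs_weighted_mean_le_one (f g : S → ℝ) (hf : ∀ s, |f s| ≤ 1) (hg0 : ∀ s, 0 ≤ g s)
    (hg : ∑ s, g s = 1) : |∑ s, f s * g s| ≤ 1 := by
  rw [← hg]
  refine (Finset.abs_sum_le_sum_abs _ _).trans (Finset.sum_le_sum fun s _ => ?_)
  rw [abs_mul, abs_of_nonneg (hg0 s)]
  exact mul_le_of_le_one_left (hg0 s) (hf s)

end WeightedSums

lemma abs_spin (b : Bool) : |spin b| = 1 := by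
  cases b <;> simp [spin]

/-- **FKG implies self-averaging of the overlap is controlled by that of the
magnetization.** For a random Gibbs measure `G` on `{−1,+1}^V` whose spin
correlations satisfy the FKG inequality `⟨σ_i σ_j⟩ ≥ ⟨σ_i⟩⟨σ_j⟩` almost surely,
the site overlap `R_{1,2} = |V|⁻¹ Σ_i σ_i¹ σ_i²` satisfies
`E⟨(R_{1,2} − ⟨R_{1,2}⟩)²⟩ ≤ 2 E⟨(m(σ) − ⟨m(σ)⟩)²⟩`. -/
theorem fkg_overlap_self_averaging
    {V : Type*} [Fintype V] [DecidableEq V] [Nonempty V]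
    {Ω : Type*} [MeasurableSpace Ω] (P : Measure Ω) [IsProbabilityMeasure P]
    (G : Ω → (V → Bool) → ℝ)
    (hGmeas : Measurable G)
    (hG0 : ∀ ω σ, 0 ≤ G ω σ) (hG1 : ∀ ω, ∑ σ, G ω σ = 1)
    (hFKG : ∀ᵐ ω ∂P, ∀ i j : V,
      (∑ σ, spin (σ i) * spin (σ j) * G ω σ) ≥
        (∑ σ, spin (σ i) * G ω σ) * ∑ σ, spin (σ j) * G ω σ) :
    (∫ ω, ∑ σ₁, ∑ σ₂,
        (((Fintype.card V : ℝ)⁻¹ * ∑ i, spin (σ₁ i) * spin (σ₂ i)) -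
          ∑ τ₁, ∑ τ₂, ((Fintype.card V : ℝ)⁻¹ * ∑ i, spin (τ₁ i) * spin (τ₂ i)) *
            G ω τ₁ * G ω τ₂) ^ 2 * G ω σ₁ * G ω σ₂ ∂P) ≤
      2 * ∫ ω, ∑ σ,
        (((Fintype.card V : ℝ)⁻¹ * ∑ i, spin (σ i)) -
          ∑ τ, ((Fintype.card V : ℝ)⁻¹ * ∑ i, spin (τ i)) * G ω τ) ^ 2 *
          G ω σ ∂P := by
  have h_bound (ω : Ω) (f : (V → Bool) → ℝ) (hf : ∀ σ, |f σ| ≤ 1) :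
      |∑ σ, f σ * G ω σ| ≤ 1 := abs_weighted_mean_le_one f (G ω) hf (hG0 ω) (hG1 ω)
  have h_meas (f : (V → Bool) → ℝ) : Measurable fun ω => ∑ σ, f σ * G ω σ :=
    Finset.measurable_sum _ fun σ _ => ((measurable_pi_apply σ).comp hGmeas).const_mul _
  have h_spin (i : V) (σ : V → Bool) : |spin (σ i)| ≤ 1 := (abs_spin _).le
  have h_spin_mul (i j : V) (σ : V → Bool) : |spin (σ i) * spin (σ j)| ≤ 1 := by
    simp [abs_mul, abs_spin]
  have h_mean_mul (i j : V) (ω : Ω) :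
      |(∑ σ, spin (σ i) * G ω σ) * ∑ σ, spin (σ j) * G ω σ| ≤ 1 := by
    rw [abs_mul]
    exact mul_le_one₀ (h_bound ω _ (h_spin i)) (abs_nonneg _) (h_bound ω _ (h_spin j))
  rw [← integral_const_mul]
  refine integral_mono_of_nonneg (Filter.Eventually.of_forall fun ω => ?_) ?_ ?_
  · exact Finset.sum_nonneg fun σ₁ _ => Finset.sum_nonneg fun σ₂ _ =>
      mul_nonneg (mul_nonneg (sq_nonneg _) (hG0 ω σ₁)) (hG0 ω σ₂)
  · refine Integrable.const_mul ?_ 2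
    simp_rw [fun ω => weighted_variance_sum (fun i (σ : V → Bool) => spin (σ i)) (G ω) (hG1 ω)]
    refine Integrable.const_mul (integrable_finsetSum _ fun i _ =>
      integrable_finsetSum _ fun j _ => Integrable.sub ?_ ?_) _
    · exact Integrable.of_bound (h_meas fun σ => spin (σ i) * spin (σ j)).aestronglyMeasurable 1
        (Filter.Eventually.of_forall fun ω => h_bound ω _ (h_spin_mul i j))
    · exact Integrable.of_bound ((h_meas fun σ => spin (σ i)).mul
        (h_meas fun σ => spin (σ j))).aestronglyMeasurable 1
        (Filter.Eventually.of_forall fun ω => h_mean_mul i j ω)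
  · filter_upwards [hFKG] with ω hω
    rw [weighted_variance_overlap (fun i (σ : V → Bool) => spin (σ i)) (G ω) (hG1 ω),
      weighted_variance_sum (fun i (σ : V → Bool) => spin (σ i)) (G ω) (hG1 ω),
      mul_left_comm]
    refine mul_le_mul_of_nonneg_left ?_ (sq_nonneg _)
    rw [Finset.mul_sum]
    refine Finset.sum_le_sum fun i _ => ?_
    rw [Finset.mul_sum]
    refine Finset.sum_le_sum fun j _ => ?_
    have h1 := (abs_le.mp (h_bound ω _ (h_spin_mul i j))).2
    have h2 := (abs_le.mp (h_mean_mul i j ω)).2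
    rw [sq_sub_sq]
    exact mul_le_mul_of_nonneg_right (by linarith) (sub_nonneg.mpr (hω i j))
end
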